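/- The explicit 15-element partial Latin square W_1 given in the context has exactly 7,075,188 completions to Latin squares of order 8; in particular, W_1 is not a uniquely completable set. -/

import Mathlib

/-- A Latin square of order `n`, represented as a function giving the entry in
row `i`, column `j`: every element occurs exactly once in each row and column. -/
def IsLatinSquare {n : ℕ} (L : Fin n → Fin n → Fin n) : Prop :=
  (∀ i, Function.Injective (L i)) ∧ (∀ j, Function.Injective fun i => L i j)

/-- The set of triples `(i, j; L i j)` of a square `L`. -/
def entries {n : ℕ} (L : Fin n → Fin n → Fin n) : Finset (Fin n × Fin n × Fin n) :=
  Finset.univ.image fun p : Fin n × Fin n => (p.1, p.2, L p.1 p.2)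

/-- `T` is a Latin trade in `L`: the (nonempty) set of entries of `L` in the positions
where `L` differs from some other Latin square `L'` of the same order. -/
def IsTrade {n : ℕ} (L : Fin n → Fin n → Fin n)
    (T : Finset (Fin n × Fin n × Fin n)) : Prop :=
  ∃ L' : Fin n → Fin n → Fin n, IsLatinSquare L' ∧ L' ≠ L ∧
    T = (Finset.univ.filter fun p : Fin n × Fin n => L p.1 p.2 ≠ L' p.1 p.2).image
          fun p => (p.1, p.2, L p.1 p.2)

/-- `U` is a uniquely completable set for `L`: `U ⊆ L` and `L` is the only
Latin square of order `n` containing `U`. -/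
def IsUC {n : ℕ} (L : Fin n → Fin n → Fin n)
    (U : Finset (Fin n × Fin n × Fin n)) : Prop :=
  U ⊆ entries L ∧
    ∀ L' : Fin n → Fin n → Fin n, IsLatinSquare L' → U ⊆ entries L' → L' = L

/-- `C` is a critical set of `L`: a uniquely completable set for `L`,
no proper subset of which is uniquely completable. -/
def IsCritical {n : ℕ} (L : Fin n → Fin n → Fin n)
    (C : Finset (Fin n × Fin n × Fin n)) : Prop :=
  IsUC L C ∧ ∀ C' ⊂ C, ¬ IsUC L C'

/-- `scs n`: the smallest size of a critical set in any Latin square of order `n`. -/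
noncomputable def scs (n : ℕ) : ℕ :=
  sInf {s | ∃ (L : Fin n → Fin n → Fin n) (C : Finset (Fin n × Fin n × Fin n)),
    IsLatinSquare L ∧ IsCritical L C ∧ C.card = s}

/-- `R(T)`: the number of distinct rows occurring in `T`. -/
def rowCount {n : ℕ} (T : Finset (Fin n × Fin n × Fin n)) : ℕ :=
  (T.image fun t => t.1).card

/-- `C(T)`: the number of distinct columns occurring in `T`. -/
def colCount {n : ℕ} (T : Finset (Fin n × Fin n × Fin n)) : ℕ :=
  (T.image fun t => t.2.1).card

/-- `E(T)`: the number of distinct elements occurring in `T`. -/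
def elemCount {n : ℕ} (T : Finset (Fin n × Fin n × Fin n)) : ℕ :=
  (T.image fun t => t.2.2).card

/-- The 15-element set `W₁` (0-based encoding of {(1,1;8),(1,3;7),(2,2;3),(2,7;1),
(3,1;6),(3,4;3),(4,5;8),(5,4;2),(5,8;4),(6,7;5),(6,8;2),(7,5;4),(7,6;7),(8,2;1),(8,3;6)}). -/
def W1 : Finset (Fin 8 × Fin 8 × Fin 8) :=
  {(0,0,7), (0,2,6), (1,1,2), (1,6,0), (2,0,5), (2,3,2), (3,4,7), (4,3,1),
   (4,7,3), (5,6,4), (5,7,1), (6,4,3), (6,5,6), (7,1,0), (7,2,5)}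

noncomputable section

/-- Places the values `f c`, for `c` running through `l`, in consecutive lanes of `W` bits. -/
def pack (W : ℕ) (f : ℕ → ℕ) (l : List ℕ) : ℕ :=
  List.rec (nat_lit 0) (fun c _ r => Nat.add (f c) (Nat.shiftLeft r W)) l

/-- The number of codes in `l`. -/
def len (l : List ℕ) : ℕ := List.rec (nat_lit 0) (fun _ _ r => Nat.succ r) l

/-- The width of a lane in which the disjointness test for a list of length `n` is carried out. -/
def lane (s n : ℕ) : ℕ := Nat.add (Nat.mul s n) (Nat.add s 65)

/-- Tests `c` against all lanes of `P` at once; `O` and `M` hold `1` and `2 ^ 64 - 1` in each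
lane. -/
def disjointLanes (k P O M c : ℕ) : ℕ :=
  Nat.mod (Nat.xor O (Nat.land O
    (Nat.shiftRight (Nat.add (Nat.land P (Nat.mul c O)) M) 64))) k

/-- The codes of `l` disjoint from `c`, as a bit set in which consecutive codes are `s` bits
apart. -/
def disjointBits (s : ℕ) (l : List ℕ) (c : ℕ) : ℕ :=
  disjointLanes (Nat.sub (Nat.pow 2 (Nat.add (Nat.mul s (len l)) 65)) 1)
    (pack (lane s (len l)) (fun d => d) l) (pack (lane s (len l)) (fun _ => nat_lit 1) l)
    (pack (lane s (len l)) (fun _ => Nat.sub (Nat.pow 2 64) 1) l) c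

/-- Bits are 8 apart in the last list, so that they can be counted modulo 255. -/
def stride (ls : List (List ℕ)) : ℕ := List.rec (nat_lit 8) (fun _ _ _ => nat_lit 1) ls

/-- The number of bits of a state for the lists `ls`. -/
def width (ls : List (List ℕ)) : ℕ :=
  List.rec (nat_lit 65) (fun l ls r => Nat.add (Nat.mul (stride ls) (len l)) r) ls

/-- The state recording which codes of the lists `ls` are disjoint from `c`, above the
complement of `c` in 65 bits. -/
def state (ls : List (List ℕ)) : ℕ → ℕ :=
  List.rec (fun c => Nat.sub (nat_lit 36893488147419103231) c) (fun l ls r c =>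
    Nat.add (r c) (Nat.shiftLeft (disjointBits (stride ls) l c) (width ls))) ls

/-- A table of the values of `f` on `l`, the one at index `i` being stored in the slot
`2 ^ i * q % 149`. -/
def table (w : ℕ) (f : ℕ → ℕ) (l : List ℕ) : ℕ → ℕ :=
  List.rec (fun _ => nat_lit 0) (fun c _ r q =>
    Nat.lor (Nat.shiftLeft (f c) (Nat.mul w q)) (r (Nat.mod (Nat.mul 2 q) 149))) l

/-- Adds 64 low bits that depend on all bits of `X`. -/
def mix (X : ℕ) : ℕ :=
  Nat.add (Nat.shiftLeft X (nat_lit 64)) (Nat.mod X (nat_lit 2305843009213693951))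

/-- Recovers `X` from the predecessor of `mix X`. -/
def unmix (z : ℕ) : ℕ := Nat.shiftRight (Nat.succ z) (nat_lit 64)

/-- Removes the lowest bit of `X`. -/
def dropBit (X : ℕ) : ℕ := Nat.land X (Nat.sub X (nat_lit 1))

/-- The slot belonging to the lowest bit of `X`. -/
def slot (X : ℕ) : ℕ := Nat.mod (Nat.sub X (dropBit X)) (nat_lit 149)

/-- The entry of the table `T` for the lowest bit of a mixed set with predecessor `z`. -/
def entry (T w z : ℕ) : ℕ :=
  Nat.rec (nat_lit 0) (fun s _ => Nat.mod (Nat.shiftRight T (Nat.mul w (Nat.succ s)))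
    (Nat.pow (nat_lit 2) w)) (slot (unmix z))

/-- A function of the state; the wrapper lets the evaluator share it between states. -/
structure Prog where
  /-- The function. -/
  run : ℕ → ℕ

/-- The sum of `g` over the intersections of a state with the entries of a mixed set. -/
def sumProg (g e : ℕ → ℕ) (n : ℕ) : ℕ → Prog :=
  Nat.rec (fun _ => ⟨fun _ => nat_lit 0⟩) (fun _ ih Z =>
    Nat.rec ⟨fun _ => nat_lit 0⟩ (fun z _ => ⟨fun A =>
      Nat.rec (nat_lit 0) (fun a _ =>
          Nat.add (g (Nat.succ a)) ((ih (mix (dropBit (unmix z)))).run A))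
        (Nat.land A (e z))⟩) Z) n

/-- The sum of bit counts over the intersections of a state with the entries of a mixed set. -/
def leafProg (e : ℕ → ℕ) (n : ℕ) : ℕ → Prog :=
  Nat.rec (fun _ => ⟨fun _ => nat_lit 0⟩) (fun _ ih Z =>
    Nat.rec ⟨fun _ => nat_lit 0⟩ (fun z _ => ⟨fun A =>
      Nat.add (Nat.mod (Nat.shiftRight (Nat.land A (e z)) (nat_lit 65)) (nat_lit 255))
        ((ih (mix (dropBit (unmix z)))).run A)⟩) Z) n

/-- Runs `p` for the set stored above bit `w` of the state `A`. -/
def runProg (p : ℕ → Prog) (w A : ℕ) : ℕ :=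
  Nat.rec (nat_lit 0) (fun z _ => (p (Nat.succ z)).run A) (mix (Nat.shiftRight A w))

/-- The count for a state, given the count `g` for states without the first list. -/
def node (g e : ℕ → ℕ) (w A : ℕ) : ℕ := runProg (sumProg g e (nat_lit 148)) w A

/-- The count for a state of two lists. -/
def leaf (e : ℕ → ℕ) (w A : ℕ) : ℕ := runProg (leafProg e (nat_lit 148)) w A

/-- Evaluates `a` before applying `f`. -/
def eager (a : ℕ) (f : ℕ → ℕ) : ℕ := Nat.rec (f (nat_lit 0)) (fun n _ => f (Nat.succ n)) a

/-- Passes to `K` the counting function built by `g` from the table for the first list `l`. -/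
def withTable (l : List ℕ) (ls : List (List ℕ)) (g : (ℕ → ℕ) → ℕ → ℕ → ℕ)
    (K : (ℕ → ℕ) → ℕ) : ℕ :=
  eager (width ls) fun w => eager (table w (state ls) l (nat_lit 1)) fun T => K (g (entry T w) w)

/-- The number of ways to choose pairwise disjoint codes from seven lists. -/
def count (l₀ l₁ l₂ l₃ l₄ l₅ l₆ : List ℕ) : ℕ :=
  withTable l₅ [l₆] leaf fun g₅ =>
  withTable l₄ [l₅, l₆] (node g₅) fun g₄ =>
  withTable l₃ [l₄, l₅, l₆] (node g₄) fun g₃ =>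
  withTable l₂ [l₃, l₄, l₅, l₆] (node g₃) fun g₂ =>
  withTable l₁ [l₂, l₃, l₄, l₅, l₆] (node g₂) fun g₁ =>
  withTable l₀ [l₁, l₂, l₃, l₄, l₅, l₆] (node g₁) fun g₀ =>
  eager (state [l₀, l₁, l₂, l₃, l₄, l₅, l₆] (nat_lit 0)) g₀

/-- Whether `l` has at most 148 elements. -/
def short (l : List ℕ) : Bool := Nat.ble (len l) (nat_lit 148)

/-- The codes `∑ i, 2 ^ (8 * i + s i)` of the injective sequences `s` with `s i` in the `i`-th
list of `als` and outside the bit set `u`. -/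
def columnCodes (als : List (List ℕ)) : ℕ → List ℕ :=
  List.rec (fun _ => [nat_lit 0]) (fun al _ ih u =>
    List.rec [] (fun v _ acc => Bool.rec
      (List.rec acc (fun c _ r => Nat.add (Nat.pow 2 v) (Nat.mul 256 c) :: r)
        (ih (Nat.lor u (Nat.pow 2 v))))
      acc (Nat.beq 1 (Nat.mod (Nat.shiftRight u v) 2))) al) als

/-- The symbols of `al` that are elements of the bit set `m`. -/
def restrict (m : ℕ) (al : List ℕ) : List ℕ :=
  List.rec [] (fun v _ r => Bool.rec r (v :: r) (Nat.beq 1 (Nat.mod (Nat.shiftRight m v) 2))) al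

/-- The symbols allowed in the `k`-th of the columns 1, 6, 7, 3, 4, 0, 2 by the clues, if the first
four of these columns have the symbols in the bit set `m` in row 3. -/
def allowed (m : ℕ) : Fin 7 → List (List ℕ)
  | 0 => [[0, 1, 2, 3, 4, 5], [2], [0, 1, 3, 4, 6, 7], restrict m [0, 1, 2, 3, 4, 5, 6],
      [0, 2, 4, 5, 6, 7], [0, 2, 3, 5, 6, 7], [0, 1, 2, 4, 5, 7], [0]]
  | 1 => [[0, 1, 2, 3, 4, 5], [0], [0, 1, 3, 4, 6, 7], restrict m [0, 1, 2, 3, 4, 5, 6],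
      [0, 2, 4, 5, 6, 7], [4], [0, 1, 2, 4, 5, 7], [1, 2, 3, 4, 6, 7]]
  | 2 => [[0, 1, 2, 3, 4, 5], [1, 3, 4, 5, 6, 7], [0, 1, 3, 4, 6, 7],
      restrict m [0, 1, 2, 3, 4, 5, 6], [3], [1], [0, 1, 2, 4, 5, 7], [1, 2, 3, 4, 6, 7]]
  | 3 => [[0, 1, 2, 3, 4, 5], [1, 3, 4, 5, 6, 7], [2], restrict m [0, 1, 2, 3, 4, 5, 6],
      [1], [0, 2, 3, 5, 6, 7], [0, 1, 2, 4, 5, 7], [1, 2, 3, 4, 6, 7]]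
  | 4 => [[0, 1, 2, 3, 4, 5], [1, 3, 4, 5, 6, 7], [0, 1, 3, 4, 6, 7], [7],
      [0, 2, 4, 5, 6, 7], [0, 2, 3, 5, 6, 7], [3], [1, 2, 3, 4, 6, 7]]
  | 5 => [[7], [1, 3, 4, 5, 6, 7], [5], restrict (Nat.sub 127 m) [0, 1, 2, 3, 4, 5, 6],
      [0, 2, 4, 5, 6, 7], [0, 2, 3, 5, 6, 7], [0, 1, 2, 4, 5, 7], [1, 2, 3, 4, 6, 7]]
  | 6 => [[6], [1, 3, 4, 5, 6, 7], [0, 1, 3, 4, 6, 7],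
      restrict (Nat.sub 127 m) [0, 1, 2, 3, 4, 5, 6],
      [0, 2, 4, 5, 6, 7], [0, 2, 3, 5, 6, 7], [0, 1, 2, 4, 5, 7], [5]]

/-- The codes of the columns allowed by the clues. -/
def codes (m : ℕ) (k : Fin 7) : List ℕ := columnCodes (allowed m k) (nat_lit 0)

/-- Whether all lists of codes have at most 148 elements. -/
def shortClass (m : ℕ) : Bool :=
  and (short (codes m 0)) <| and (short (codes m 1)) <| and (short (codes m 2)) <|
  and (short (codes m 3)) <| and (short (codes m 4)) <| and (short (codes m 5)) <|
  short (codes m 6)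

/-- The number of completions for which the columns 1, 6, 7, 3 have the symbols in `m` in row 3. -/
def classCount (m : ℕ) : ℕ :=
  count (codes m 0) (codes m 1) (codes m 2) (codes m 3) (codes m 4) (codes m 5) (codes m 6)

/-- Bundles the length check with the value of the count. -/
def classCheck (m v : ℕ) : Bool := and (shortClass m) (Nat.beq (classCount m) v)

theorem pack_cons (W : ℕ) (f : ℕ → ℕ) (c : ℕ) (l : List ℕ) :
    pack W f (c :: l) = 2 ^ W * pack W f l + f c := by
  change f c + pack W f l <<< W = _
  rw [Nat.shiftLeft_eq]; ring

theorem len_eq (l : List ℕ) : len l = l.length := by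
  induction l with
  | nil => rfl
  | cons c l ih => rw [List.length_cons, ← ih]; rfl

theorem pack_congr {W : ℕ} {f g : ℕ → ℕ} {l : List ℕ} (h : ∀ c ∈ l, f c = g c) :
    pack W f l = pack W g l := by
  induction l with
  | nil => rfl
  | cons c l ih => simp_all [pack_cons]

theorem mul_pack (W a : ℕ) (f : ℕ → ℕ) (l : List ℕ) :
    a * pack W f l = pack W (fun c => a * f c) l := by
  induction l with
  | nil => rfl
  | cons c l ih => rw [pack_cons, pack_cons, ← ih]; ring

theorem pack_add_pack (W : ℕ) (f g : ℕ → ℕ) (l : List ℕ) :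
    pack W f l + pack W g l = pack W (fun c => f c + g c) l := by
  induction l with
  | nil => rfl
  | cons c l ih => rw [pack_cons, pack_cons, pack_cons, ← ih]; ring

theorem land_two_pow_mul_add {W a b : ℕ} (ha : a < 2 ^ W) (hb : b < 2 ^ W) (r s : ℕ) :
    (2 ^ W * r + a) &&& (2 ^ W * s + b) = 2 ^ W * (r &&& s) + (a &&& b) := by
  apply Nat.eq_of_testBit_eq
  intro i
  have hab : a &&& b < 2 ^ W := lt_of_le_of_lt Nat.and_le_left ha
  simp only [Nat.testBit_and, Nat.testBit_two_pow_mul_add _ ha, Nat.testBit_two_pow_mul_add _ hb,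
    Nat.testBit_two_pow_mul_add _ hab]
  split <;> rfl

theorem xor_two_pow_mul_add {W a b : ℕ} (ha : a < 2 ^ W) (hb : b < 2 ^ W) (r s : ℕ) :
    (2 ^ W * r + a) ^^^ (2 ^ W * s + b) = 2 ^ W * (r ^^^ s) + (a ^^^ b) := by
  apply Nat.eq_of_testBit_eq
  intro i
  have hab : a ^^^ b < 2 ^ W := Nat.xor_lt_two_pow ha hb
  simp only [Nat.testBit_xor, Nat.testBit_two_pow_mul_add _ ha, Nat.testBit_two_pow_mul_add _ hb,
    Nat.testBit_two_pow_mul_add _ hab]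
  split <;> rfl

theorem pack_land_pack {W : ℕ} {f g : ℕ → ℕ} {l : List ℕ} (hf : ∀ c ∈ l, f c < 2 ^ W)
    (hg : ∀ c ∈ l, g c < 2 ^ W) :
    pack W f l &&& pack W g l = pack W (fun c => f c &&& g c) l := by
  induction l with
  | nil => exact Nat.and_self 0
  | cons c l ih =>
    simp only [List.forall_mem_cons] at hf hg
    rw [pack_cons, pack_cons, pack_cons, land_two_pow_mul_add hf.1 hg.1, ih hf.2 hg.2]

theorem pack_xor_pack {W : ℕ} {f g : ℕ → ℕ} {l : List ℕ} (hf : ∀ c ∈ l, f c < 2 ^ W)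
    (hg : ∀ c ∈ l, g c < 2 ^ W) :
    pack W f l ^^^ pack W g l = pack W (fun c => f c ^^^ g c) l := by
  induction l with
  | nil => exact Nat.xor_self 0
  | cons c l ih =>
    simp only [List.forall_mem_cons] at hf hg
    rw [pack_cons, pack_cons, pack_cons, xor_two_pow_mul_add hf.1 hg.1, ih hf.2 hg.2]

/-- The bit set of the elements of `l` disjoint from `c`, consecutive elements being `s` bits
apart. -/
def disjointSet (s : ℕ) (l : List ℕ) (c : ℕ) : ℕ :=
  pack s (fun d => if d &&& c = 0 then 1 else 0) l

theorem pack_lt {s : ℕ} {f : ℕ → ℕ} {l : List ℕ} (hf : ∀ c ∈ l, f c < 2 ^ s) :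
    pack s f l < 2 ^ (s * l.length) := by
  induction l with
  | nil => simp [pack]
  | cons c l ih =>
    simp only [List.forall_mem_cons] at hf
    have := ih hf.2
    rw [pack_cons, List.length_cons, Nat.mul_succ, Nat.add_comm (s * _), pow_add]
    nlinarith [hf.1]

theorem disjointSet_lt {s : ℕ} (hs : 0 < s) (l : List ℕ) (c : ℕ) :
    disjointSet s l c < 2 ^ (s * l.length) := by
  refine pack_lt fun d _ => ?_
  have : 1 < 2 ^ s := Nat.one_lt_two_pow hs.ne'
  split <;> omega

theorem pack_modEq {k W s : ℕ} (h : 2 ^ W ≡ 2 ^ s [MOD k]) (f : ℕ → ℕ) (l : List ℕ) :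
    pack W f l ≡ pack s f l [MOD k] := by
  induction l with
  | nil => rfl
  | cons c l ih =>
    rw [pack_cons, pack_cons]
    exact (h.mul ih).add_right _

theorem two_pow_add_modEq (s t : ℕ) : 2 ^ (s + t) ≡ 2 ^ s [MOD 2 ^ t - 1] := by
  have h : 2 ^ t ≡ 1 [MOD 2 ^ t - 1] :=
    ((Nat.modEq_iff_dvd' Nat.one_le_two_pow).2 dvd_rfl).symm
  simpa [pow_add] using h.mul_left (2 ^ s)

theorem land_two_pow_64 {x : ℕ} (hx : x < 2 ^ 64) :
    2 ^ 64 &&& (x + (2 ^ 64 - 1)) = 2 ^ 64 * if x = 0 then 0 else 1 := by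
  split_ifs with h
  · subst h; decide
  · obtain ⟨y, rfl⟩ := Nat.exists_eq_succ_of_ne_zero h
    have hy : y < 2 ^ 64 := by omega
    have h1 : y.succ + (2 ^ 64 - 1) = 2 ^ 64 * 1 + y := by omega
    have h2 := land_two_pow_mul_add (W := 64) (a := 0) (by norm_num) hy 1 1
    rw [h1]
    simpa using h2

theorem disjointBits_eq {s : ℕ} (hs : 0 < s) {l : List ℕ} (hl : ∀ d ∈ l, d < 2 ^ 64) {c : ℕ}
    (hc : c < 2 ^ 64) : disjointBits s l c = disjointSet s l c := by
  have hk : 2 ^ 65 ≤ 2 ^ (s * l.length + 65) := Nat.pow_le_pow_right (by norm_num) (by omega)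
  have hW : 2 ^ 65 ≤ 2 ^ lane s l.length := by
    refine Nat.pow_le_pow_right (by norm_num) ?_
    change 65 ≤ s * l.length + (s + 65)
    omega
  set W := lane s l.length with hWdef
  have hWs : W = s + (s * l.length + 65) := by
    change s * l.length + (s + 65) = _
    omega
  unfold disjointBits disjointLanes
  rw [len_eq, ← hWdef]
  change (pack W (fun _ => 1) l ^^^ (pack W (fun _ => 1) l &&&
    (((pack W (fun d => d) l &&& c * pack W (fun _ => 1) l) + pack W (fun _ => 2 ^ 64 - 1) l)
      >>> 64))) % (2 ^ (s * l.length + 65) - 1) = _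
  have hand : ∀ d ∈ l, d &&& c < 2 ^ 64 := fun d _ => lt_of_le_of_lt Nat.and_le_right hc
  have hshift : ∀ x y : ℕ, x &&& (y >>> 64) = ((2 ^ 64 * x) &&& y) >>> 64 := by
    intro x y
    rw [Nat.shiftRight_and_distrib, Nat.shiftRight_eq_div_pow (2 ^ 64 * x),
      Nat.mul_div_cancel_left _ (by positivity)]
  rw [mul_pack, pack_land_pack (fun d hd => by have := hl d hd; omega) (fun d _ => by omega),
    pack_add_pack, hshift, mul_pack,
    pack_land_pack (fun _ _ => by omega)
      (fun d hd => by have := hand d hd; simp only [mul_one]; omega)]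
  rw [pack_congr (f := fun d => 2 ^ 64 * 1 &&& (d &&& c * 1) + (2 ^ 64 - 1))
    (g := fun d => 2 ^ 64 * if d &&& c = 0 then 0 else 1) (fun d hd => by
    simpa only [mul_one] using land_two_pow_64 (hand d hd)), ← mul_pack,
    Nat.shiftRight_eq_div_pow, Nat.mul_div_cancel_left _ (by positivity),
    pack_xor_pack (fun _ _ => by omega) (fun d _ => by split <;> omega)]
  rw [pack_congr (g := fun d => if d &&& c = 0 then 1 else 0) (fun d _ => by
    split <;> rfl)]
  have hmod : 2 ^ W ≡ 2 ^ s [MOD 2 ^ (s * l.length + 65) - 1] := by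
    rw [hWs]
    exact two_pow_add_modEq s _
  refine Eq.trans (pack_modEq hmod _ l) ?_
  refine Nat.mod_eq_of_lt (lt_of_lt_of_le (disjointSet_lt hs l c) ?_)
  have : 0 < 2 ^ (s * l.length) := by positivity
  rw [pow_add]
  omega

theorem land_lor_eq_zero {d a b : ℕ} : d &&& (a ||| b) = 0 ↔ d &&& a = 0 ∧ d &&& b = 0 := by
  rw [Nat.and_or_distrib_left, Nat.or_eq_zero_iff]

theorem disjointSet_land {s : ℕ} (hs : 0 < s) (l : List ℕ) (a b : ℕ) :
    disjointSet s l a &&& disjointSet s l b = disjointSet s l (a ||| b) := by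
  have h1 : 1 < 2 ^ s := Nat.one_lt_two_pow hs.ne'
  unfold disjointSet
  rw [pack_land_pack (fun _ _ => by split <;> omega)
    (fun _ _ => by split <;> omega)]
  refine pack_congr fun d _ => ?_
  simp only [land_lor_eq_zero]
  by_cases h : d &&& a = 0 <;> by_cases h' : d &&& b = 0 <;> simp [h, h']

theorem stride_pos (ls : List (List ℕ)) : 0 < stride ls := by
  cases ls
  exacts [Nat.zero_lt_succ 7, Nat.zero_lt_one]

theorem width_cons (l : List ℕ) (ls : List (List ℕ)) :
    width (l :: ls) = stride ls * l.length + width ls := by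
  rw [← len_eq]; rfl

theorem state_nil (c : ℕ) : state [] c = 2 ^ 65 - 1 - c := rfl

theorem state_cons {l : List ℕ} (hl : ∀ d ∈ l, d < 2 ^ 64) (ls : List (List ℕ)) {c : ℕ}
    (hc : c < 2 ^ 64) :
    state (l :: ls) c = 2 ^ width ls * disjointSet (stride ls) l c + state ls c := by
  rw [← disjointBits_eq (stride_pos ls) hl hc, mul_comm, ← Nat.shiftLeft_eq, add_comm]
  rfl

theorem state_lt {ls : List (List ℕ)} (hls : ∀ l ∈ ls, ∀ d ∈ l, d < 2 ^ 64) {c : ℕ}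
    (hc : c < 2 ^ 64) : state ls c < 2 ^ width ls := by
  induction ls with
  | nil => rw [state_nil]; change _ < 2 ^ 65; omega
  | cons l ls ih =>
    simp only [List.forall_mem_cons] at hls
    rw [state_cons hls.1 ls hc, width_cons, pow_add]
    have := disjointSet_lt (stride_pos ls) l c
    nlinarith [ih hls.2]

theorem sub_land_sub {n a b : ℕ} (ha : a < 2 ^ n) (hb : b < 2 ^ n) :
    (2 ^ n - 1 - a) &&& (2 ^ n - 1 - b) = 2 ^ n - 1 - (a ||| b) := by
  apply Nat.eq_of_testBit_eq
  intro i
  have hab := Nat.or_lt_two_pow ha hb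
  have e : ∀ x, 2 ^ n - 1 - x = 2 ^ n - (x + 1) := fun x => by omega
  rw [e, e, e, Nat.testBit_and, Nat.testBit_two_pow_sub_succ ha, Nat.testBit_two_pow_sub_succ hb,
    Nat.testBit_two_pow_sub_succ hab, Nat.testBit_or]
  cases decide (i < n) <;> cases a.testBit i <;> cases b.testBit i <;> rfl

theorem state_land {ls : List (List ℕ)} (hls : ∀ l ∈ ls, ∀ d ∈ l, d < 2 ^ 64) {a b : ℕ}
    (ha : a < 2 ^ 64) (hb : b < 2 ^ 64) : state ls a &&& state ls b = state ls (a ||| b) := by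
  induction ls with
  | nil => exact sub_land_sub (n := 65) (ha.trans (by norm_num)) (hb.trans (by norm_num))
  | cons l ls ih =>
    simp only [List.forall_mem_cons] at hls
    rw [state_cons hls.1 ls ha, state_cons hls.1 ls hb,
      state_cons hls.1 ls (Nat.or_lt_two_pow ha hb),
      land_two_pow_mul_add (state_lt hls.2 ha) (state_lt hls.2 hb), ih hls.2,
      disjointSet_land (stride_pos ls)]

theorem state_pos {ls : List (List ℕ)} (hls : ∀ l ∈ ls, ∀ d ∈ l, d < 2 ^ 64) {c : ℕ}
    (hc : c < 2 ^ 64) : 0 < state ls c := by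
  induction ls with
  | nil => rw [state_nil]; omega
  | cons l ls ih =>
    simp only [List.forall_mem_cons] at hls
    rw [state_cons hls.1 ls hc]
    exact Nat.add_pos_right _ (ih hls.2)

theorem table_cons (w : ℕ) (f : ℕ → ℕ) (c : ℕ) (l : List ℕ) (q : ℕ) :
    table w f (c :: l) q = f c <<< (w * q) ||| table w f l (2 * q % 149) := rfl

theorem shiftLeft_shiftRight_mod {w a : ℕ} (ha : a < 2 ^ w) (p q : ℕ) :
    a <<< (w * q) >>> (w * p) % 2 ^ w = if q = p then a else 0 := by
  rcases lt_trichotomy q p with h | rfl | h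
  · obtain ⟨r, rfl⟩ := Nat.exists_eq_add_of_lt h
    rw [if_neg h.ne, mul_add, mul_add, add_assoc, Nat.shiftRight_add, Nat.shiftLeft_shiftRight,
      add_comm, mul_one, Nat.shiftRight_add, Nat.shiftRight_eq_div_pow a, Nat.div_eq_of_lt ha]
    simp
  · rw [if_pos rfl, Nat.shiftLeft_shiftRight, Nat.mod_eq_of_lt ha]
  · obtain ⟨r, rfl⟩ := Nat.exists_eq_add_of_lt h
    rw [if_neg h.ne', mul_add, mul_add, add_assoc, add_comm, Nat.shiftLeft_add,
      Nat.shiftLeft_shiftRight, mul_one, Nat.shiftLeft_add, Nat.shiftLeft_eq, Nat.mul_mod_left]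

theorem table_cons_lookup {w : ℕ} {f : ℕ → ℕ} {c : ℕ} (hc : f c < 2 ^ w) (l : List ℕ) (p q : ℕ) :
    table w f (c :: l) q >>> (w * p) % 2 ^ w =
      (if q = p then f c else 0) ||| table w f l (2 * q % 149) >>> (w * p) % 2 ^ w := by
  rw [table_cons, Nat.shiftRight_or_distrib, Nat.or_mod_two_pow, shiftLeft_shiftRight_mod hc]

theorem two_pow_succ_mul_mod (j q m : ℕ) : 2 ^ (j + 1) * q % m = 2 ^ j * (2 * q % m) % m := by
  rw [pow_succ, mul_assoc, Nat.mul_mod_mod]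

theorem table_lookup_eq_zero {w : ℕ} {f : ℕ → ℕ} {l : List ℕ} (hf : ∀ c ∈ l, f c < 2 ^ w)
    {p q : ℕ} (hq : q < 149) (hp : ∀ i < l.length, 2 ^ i * q % 149 ≠ p) :
    table w f l q >>> (w * p) % 2 ^ w = 0 := by
  induction l generalizing q with
  | nil => exact (congrArg (· % 2 ^ w) (Nat.zero_shiftRight _)).trans (Nat.zero_mod _)
  | cons c l ih =>
    simp only [List.forall_mem_cons] at hf
    have h0 : q ≠ p := by simpa [Nat.mod_eq_of_lt hq] using hp 0 (by simp)
    rw [table_cons_lookup hf.1, if_neg h0, ih hf.2 (Nat.mod_lt _ (by norm_num)), Nat.or_zero]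
    intro i hi
    exact two_pow_succ_mul_mod i q 149 ▸ hp (i + 1) (by simpa using hi)

theorem table_lookup {w : ℕ} {f : ℕ → ℕ} {l : List ℕ} (hf : ∀ c ∈ l, f c < 2 ^ w)
    {p q i : ℕ} (hq : q < 149) (hi : i < l.length) (hp : 2 ^ i * q % 149 = p)
    (huniq : ∀ j < l.length, 2 ^ j * q % 149 = p → j = i) :
    table w f l q >>> (w * p) % 2 ^ w = f l[i] := by
  induction l generalizing q i with
  | nil => simp at hi
  | cons c l ih =>
    simp only [List.forall_mem_cons] at hf
    rw [table_cons_lookup hf.1]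
    cases i with
    | zero =>
      rw [if_pos (by simpa [Nat.mod_eq_of_lt hq] using hp),
        table_lookup_eq_zero hf.2 (Nat.mod_lt _ (by norm_num)), Nat.or_zero]
      · rfl
      · intro j hj h
        have := huniq (j + 1) (by simpa using hj) ((two_pow_succ_mul_mod j q 149).trans h)
        omega
    | succ i =>
      have hqp : q ≠ p := fun h => by
        have := huniq 0 (by simp) (by simpa [Nat.mod_eq_of_lt hq] using h)
        omega
      rw [if_neg hqp, Nat.zero_or, List.getElem_cons_succ]
      refine ih hf.2 (Nat.mod_lt _ (by norm_num)) (by simpa using hi)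
        ((two_pow_succ_mul_mod i q 149).symm.trans hp) fun j hj h => ?_
      have := huniq (j + 1) (by simpa using hj) ((two_pow_succ_mul_mod j q 149).trans h)
      omega

theorem nodup_two_pow_mod : ((List.range 148).map fun i => 2 ^ i % 149).Nodup := by
  decide +kernel

theorem two_pow_mod_inj {i j : ℕ} (hi : i < 148) (hj : j < 148) (h : 2 ^ i % 149 = 2 ^ j % 149) :
    i = j :=
  List.inj_on_of_nodup_map nodup_two_pow_mod (List.mem_range.2 hi) (List.mem_range.2 hj) h

theorem entry_eq {w : ℕ} {f : ℕ → ℕ} {l : List ℕ} (hl : l.length ≤ 148)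
    (hf : ∀ c ∈ l, f c < 2 ^ w) {i z : ℕ} (hi : i < l.length) (hz : slot (unmix z) = 2 ^ i % 149) :
    entry (table w f l 1) w z = f l[i] := by
  have hne : 2 ^ i % 149 ≠ 0 := fun h => by
    have := (Nat.Prime.dvd_of_dvd_pow (by norm_num) (Nat.dvd_of_mod_eq_zero h) : 149 ∣ 2)
    omega
  have key := table_lookup (p := 2 ^ i % 149) (q := 1) hf (by norm_num) hi (by rw [mul_one])
    (fun j hj h => two_pow_mod_inj (by omega) (by omega) (by simpa using h))
  rw [← key]
  unfold entry
  rw [hz]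
  obtain ⟨s, hs⟩ := Nat.exists_eq_succ_of_ne_zero hne
  rw [hs]
  rfl

theorem mix_zero : mix 0 = 0 := rfl

theorem mix_shiftRight (X : ℕ) : mix X >>> 64 = X := by
  change (X <<< 64 + X % 2305843009213693951) >>> 64 = X
  have := Nat.mod_lt X (show 2305843009213693951 > 0 by norm_num)
  rw [Nat.shiftLeft_eq, Nat.shiftRight_eq_div_pow]
  omega

theorem exists_mix_eq_succ {X : ℕ} (hX : X ≠ 0) : ∃ z, mix X = Nat.succ z ∧ unmix z = X := by
  obtain ⟨z, hz⟩ := Nat.exists_eq_succ_of_ne_zero (n := mix X) (fun h => hX (by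
    rw [← mix_shiftRight X, h, Nat.zero_shiftRight]))
  refine ⟨z, hz, ?_⟩
  change z.succ >>> 64 = X
  rw [← hz, mix_shiftRight]

theorem dropBit_two_pow_mul (j r : ℕ) : dropBit (2 ^ j * (2 * r + 1)) = 2 ^ (j + 1) * r := by
  have hp : 0 < 2 ^ j := by positivity
  have e1 : 2 ^ j * (2 * r + 1) = 2 ^ (j + 1) * r + 2 ^ j := by rw [pow_succ]; ring
  have e2 : 2 ^ j * (2 * r + 1) - 1 = 2 ^ (j + 1) * r + (2 ^ j - 1) := by omega
  change 2 ^ j * (2 * r + 1) &&& (2 ^ j * (2 * r + 1) - 1) = _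
  rw [e2, e1, land_two_pow_mul_add (by rw [pow_succ]; omega) (by rw [pow_succ]; omega),
    Nat.and_self, Nat.and_two_pow_sub_one_eq_mod, Nat.mod_self, Nat.add_zero]

theorem slot_two_pow_mul (j r : ℕ) : slot (2 ^ j * (2 * r + 1)) = 2 ^ j % 149 := by
  change (2 ^ j * (2 * r + 1) - dropBit (2 ^ j * (2 * r + 1))) % 149 = _
  rw [dropBit_two_pow_mul, pow_succ]
  congr 1
  rw [mul_add, mul_one, mul_assoc, Nat.add_sub_cancel_left]

/-- The number of ways to choose pairwise disjoint codes, also disjoint from `U`, from the lists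
`ls`. -/
def choices : List (List ℕ) → ℕ → ℕ
  | [], _ => 1
  | l :: ls, U => (l.map fun c => if c &&& U = 0 then choices ls (U ||| c) else 0).sum

theorem disjointSet_one_cons (c : ℕ) (l : List ℕ) (U : ℕ) :
    disjointSet 1 (c :: l) U = 2 * disjointSet 1 l U + if c &&& U = 0 then 1 else 0 := by
  unfold disjointSet
  rw [pack_cons, pow_one]

/-- A loop over the bits of a mixed set that adds up terms `t` evaluates to the sum of the terms
over the codes in the set. -/
theorem run_eq_sum {P : ℕ → ℕ → Prog} {t : ℕ → ℕ} {U A : ℕ} (l : List ℕ) (j n : ℕ)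
    (hn : l.length ≤ n) (h0 : ∀ n, (P n 0).run A = 0)
    (hsucc : ∀ n z i, (hi : i < l.length) → slot (unmix z) = 2 ^ (j + i) % 149 → l[i] &&& U = 0 →
      (P (n + 1) (Nat.succ z)).run A = t l[i] + (P n (mix (dropBit (unmix z)))).run A) :
    (P n (mix (2 ^ j * disjointSet 1 l U))).run A =
      (l.map fun c => if c &&& U = 0 then t c else 0).sum := by
  induction l generalizing j n with
  | nil =>
    have h : 2 ^ j * disjointSet 1 [] U = 0 := Nat.mul_zero _
    rw [h, mix_zero, h0]
    rfl
  | cons c l ih =>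
    rw [List.length_cons] at hn
    have ih' := fun n (hn : l.length ≤ n) => ih (j + 1) n hn fun n z i hi hz hU =>
      hsucc n z (i + 1) (by simpa using hi) (by rw [hz]; congr 2; omega) hU
    rw [disjointSet_one_cons, List.map_cons, List.sum_cons]
    split_ifs with hcU
    · obtain ⟨z, hz, hX⟩ := exists_mix_eq_succ (X := 2 ^ j * (2 * disjointSet 1 l U + 1))
        (by positivity)
      obtain ⟨n, rfl⟩ : ∃ k, n = k + 1 := ⟨n - 1, by omega⟩
      rw [hz, hsucc n z 0 (by simp) (by rw [hX, slot_two_pow_mul, add_zero]) hcU, hX,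
        dropBit_two_pow_mul, ih' n (by omega)]
      rfl
    · rw [← ih' n (by omega), add_zero, zero_add, pow_succ, mul_assoc]

theorem state_shiftRight {l : List ℕ} {ls : List (List ℕ)}
    (hl : ∀ l' ∈ l :: ls, ∀ d ∈ l', d < 2 ^ 64) {U : ℕ} (hU : U < 2 ^ 64) :
    state (l :: ls) U >>> width ls = disjointSet (stride ls) l U := by
  simp only [List.forall_mem_cons] at hl
  rw [state_cons hl.1 ls hU, Nat.shiftRight_eq_div_pow, Nat.mul_add_div (by positivity),
    Nat.div_eq_of_lt (state_lt hl.2 hU), add_zero]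

theorem state_cons_land_state {l : List ℕ} {ls : List (List ℕ)}
    (hl : ∀ l' ∈ l :: ls, ∀ d ∈ l', d < 2 ^ 64) {U c : ℕ} (hU : U < 2 ^ 64) (hc : c < 2 ^ 64) :
    state (l :: ls) U &&& state ls c = state ls (U ||| c) := by
  simp only [List.forall_mem_cons] at hl
  have h := land_two_pow_mul_add (state_lt hl.2 hU) (state_lt hl.2 hc)
    (disjointSet (stride ls) l U) 0
  rwa [mul_zero, zero_add, ← state_cons hl.1 ls hU, Nat.and_zero, mul_zero, zero_add,
    state_land hl.2 hU hc] at h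

theorem runProg_eq {p : ℕ → Prog} {w A : ℕ} (h0 : (p 0).run A = 0) :
    runProg p w A = (p (mix (A >>> w))).run A := by
  change (Nat.rec (nat_lit 0) (fun z _ => (p (Nat.succ z)).run A) (mix (A >>> w)) : ℕ) = _
  cases mix (A >>> w)
  exacts [h0.symm, rfl]

theorem sumProg_zero (g e : ℕ → ℕ) (n A : ℕ) : (sumProg g e n 0).run A = 0 := by
  cases n <;> rfl

theorem leafProg_zero (e : ℕ → ℕ) (n A : ℕ) : (leafProg e n 0).run A = 0 := by
  cases n <;> rfl

theorem sumProg_succ (g e : ℕ → ℕ) (n z : ℕ) {A : ℕ} (h : A &&& e z ≠ 0) :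
    (sumProg g e (n + 1) (Nat.succ z)).run A =
      g (A &&& e z) + (sumProg g e n (mix (dropBit (unmix z)))).run A := by
  change (Nat.rec (nat_lit 0) (fun a _ => Nat.add (g (Nat.succ a))
    ((sumProg g e n (mix (dropBit (unmix z)))).run A)) (A &&& e z) : ℕ) = _
  obtain ⟨a, ha⟩ := Nat.exists_eq_succ_of_ne_zero h
  rw [ha]
  rfl

theorem leafProg_succ (e : ℕ → ℕ) (n z A : ℕ) :
    (leafProg e (n + 1) (Nat.succ z)).run A =
      (A &&& e z) >>> 65 % 255 + (leafProg e n (mix (dropBit (unmix z)))).run A := rfl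

theorem node_eq_choices {l l' : List ℕ} {ls : List (List ℕ)} {g : ℕ → ℕ} (hlen : l.length ≤ 148)
    (hl : ∀ l'' ∈ l :: l' :: ls, ∀ d ∈ l'', d < 2 ^ 64)
    (hg : ∀ U < 2 ^ 64, g (state (l' :: ls) U) = choices (l' :: ls) U) {U : ℕ} (hU : U < 2 ^ 64) :
    node g (entry (table (width (l' :: ls)) (state (l' :: ls)) l 1) (width (l' :: ls)))
      (width (l' :: ls)) (state (l :: l' :: ls) U) = choices (l :: l' :: ls) U := by
  have hl' := (List.forall_mem_cons.1 hl).2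
  have hl₀ := (List.forall_mem_cons.1 hl).1
  unfold node
  rw [runProg_eq (sumProg_zero _ _ _ _), state_shiftRight hl hU]
  have := run_eq_sum (P := sumProg g (entry (table (width (l' :: ls)) (state (l' :: ls)) l 1)
      (width (l' :: ls)))) (t := fun c => choices (l' :: ls) (U ||| c)) (U := U)
      (A := state (l :: l' :: ls) U) l 0 148 hlen (fun n => sumProg_zero _ _ _ _) ?_
  · rw [pow_zero, one_mul] at this
    exact this
  · intro n z i hi hz _
    rw [zero_add] at hz
    have hc : l[i] < 2 ^ 64 := hl₀ _ (List.getElem_mem hi)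
    have he := entry_eq hlen (fun c hc => state_lt hl' (hl₀ c hc)) hi hz
    have hA := state_cons_land_state hl hU hc
    rw [sumProg_succ _ _ _ _ (by rw [he, hA]; exact (state_pos hl' (Nat.or_lt_two_pow hU hc)).ne'),
      he, hA, hg _ (Nat.or_lt_two_pow hU hc)]

theorem pack_mod_255 (f : ℕ → ℕ) (l : List ℕ) : pack 8 f l % 255 = (l.map f).sum % 255 := by
  induction l with
  | nil => rfl
  | cons c l ih => rw [pack_cons, List.map_cons, List.sum_cons]; omega

theorem choices_singleton (l : List ℕ) (U : ℕ) :
    choices [l] U = (l.map fun c => if c &&& U = 0 then 1 else 0).sum := rfl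

theorem choices_singleton_le (l : List ℕ) (U : ℕ) : choices [l] U ≤ l.length := by
  rw [choices_singleton]
  induction l with
  | nil => simp
  | cons c l ih => rw [List.map_cons, List.sum_cons, List.length_cons]; split <;> omega

theorem leaf_eq_choices {l l' : List ℕ} (hlen : l.length ≤ 148) (hlen' : l'.length ≤ 148)
    (hl : ∀ l'' ∈ [l, l'], ∀ d ∈ l'', d < 2 ^ 64) {U : ℕ} (hU : U < 2 ^ 64) :
    leaf (entry (table (width [l']) (state [l']) l 1) (width [l'])) (width [l'])
      (state [l, l'] U) = choices [l, l'] U := by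
  have hl' := (List.forall_mem_cons.1 hl).2
  have hl₀ := (List.forall_mem_cons.1 hl).1
  unfold leaf
  rw [runProg_eq (leafProg_zero _ _ _), state_shiftRight hl hU]
  have := run_eq_sum (P := leafProg (entry (table (width [l']) (state [l']) l 1) (width [l'])))
      (t := fun c => choices [l'] (U ||| c)) (U := U)
      (A := state [l, l'] U) l 0 148 hlen (fun n => leafProg_zero _ _ _) ?_
  · rw [pow_zero, one_mul] at this
    exact this
  · intro n z i hi hz _
    rw [zero_add] at hz
    have hc : l[i] < 2 ^ 64 := hl₀ _ (List.getElem_mem hi)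
    have he := entry_eq hlen (fun c hc => state_lt hl' (hl₀ c hc)) hi hz
    have hA := state_cons_land_state hl hU hc
    have hs : state [l'] (U ||| l[i]) >>> 65 = disjointSet 8 l' (U ||| l[i]) :=
      state_shiftRight (ls := []) hl' (Nat.or_lt_two_pow hU hc)
    rw [leafProg_succ, he, hA, hs]
    congr 1
    refine (pack_mod_255 _ _).trans (Nat.mod_eq_of_lt ?_)
    have := choices_singleton_le l' (U ||| l[i])
    rw [choices_singleton] at this
    omega

theorem eager_eq (a : ℕ) (f : ℕ → ℕ) : eager a f = f a := by
  cases a <;> rfl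

theorem withTable_eq (l : List ℕ) (ls : List (List ℕ)) (g : (ℕ → ℕ) → ℕ → ℕ → ℕ)
    (K : (ℕ → ℕ) → ℕ) :
    withTable l ls g K = K (g (entry (table (width ls) (state ls) l 1) (width ls)) (width ls)) := by
  unfold withTable
  rw [eager_eq, eager_eq]

theorem count_eq_choices {l₀ l₁ l₂ l₃ l₄ l₅ l₆ : List ℕ}
    (hlen : ∀ l ∈ [l₀, l₁, l₂, l₃, l₄, l₅, l₆], l.length ≤ 148)
    (hl : ∀ l ∈ [l₀, l₁, l₂, l₃, l₄, l₅, l₆], ∀ d ∈ l, d < 2 ^ 64) :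
    count l₀ l₁ l₂ l₃ l₄ l₅ l₆ = choices [l₀, l₁, l₂, l₃, l₄, l₅, l₆] 0 := by
  unfold count
  simp only [withTable_eq, eager_eq]
  simp only [List.forall_mem_cons] at hlen
  obtain ⟨n₀, n₁, n₂, n₃, n₄, n₅, n₆, -⟩ := hlen
  have t₁ := (List.forall_mem_cons.1 hl).2
  have t₂ := (List.forall_mem_cons.1 t₁).2
  have t₃ := (List.forall_mem_cons.1 t₂).2
  have t₄ := (List.forall_mem_cons.1 t₃).2
  have t₅ := (List.forall_mem_cons.1 t₄).2
  refine node_eq_choices n₀ hl (fun _ => ?_) (by norm_num)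
  refine node_eq_choices n₁ t₁ fun _ => ?_
  refine node_eq_choices n₂ t₂ fun _ => ?_
  refine node_eq_choices n₃ t₃ fun _ => ?_
  refine node_eq_choices n₄ t₄ fun _ => ?_
  exact leaf_eq_choices n₅ n₆ t₅

/-- The code of a sequence of symbols. -/
def code : List ℕ → ℕ
  | [] => 0
  | v :: s => 2 ^ 8 * code s + 2 ^ v

theorem two_pow_lt_two_pow_8 {v : ℕ} (hv : v < 8) : 2 ^ v < 2 ^ 8 :=
  Nat.pow_lt_pow_right (by norm_num) hv

theorem two_pow_8_mul_add_inj {a b r s : ℕ} (ha : a < 2 ^ 8) (hb : b < 2 ^ 8)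
    (h : 2 ^ 8 * r + a = 2 ^ 8 * s + b) : r = s ∧ a = b := by
  omega

theorem beq_shiftRight_mod (u v : ℕ) :
    Nat.beq 1 (Nat.mod (Nat.shiftRight u v) 2) = u.testBit v := by
  change Nat.beq 1 (u >>> v % 2) = _
  rw [Nat.testBit_eq_decide_div_mod_eq, Nat.shiftRight_eq_div_pow]
  rcases Nat.mod_two_eq_zero_or_one (u / 2 ^ v) with h | h <;> rw [h] <;> rfl

theorem columnCodes_cons (al : List ℕ) (als : List (List ℕ)) (u : ℕ) :
    columnCodes (al :: als) u = al.flatMap fun v => if u.testBit v then [] else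
      (columnCodes als (u ||| 2 ^ v)).map fun c => 2 ^ 8 * c + 2 ^ v := by
  induction al with
  | nil => rfl
  | cons v al ih =>
    rw [List.flatMap_cons, ← ih, ← beq_shiftRight_mod]
    change (Bool.rec (List.rec _ _ _) _ (Nat.beq 1 (Nat.mod (Nat.shiftRight u v) 2)) :
      List ℕ) = _
    cases Nat.beq 1 (Nat.mod (Nat.shiftRight u v) 2)
    · change (List.rec (columnCodes (al :: als) u)
        (fun c _ r => Nat.add (Nat.pow 2 v) (Nat.mul 256 c) :: r)
        (columnCodes als (u ||| 2 ^ v)) : List ℕ) = _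
      simp only [Bool.false_eq_true, if_false]
      induction columnCodes als (u ||| 2 ^ v) with
      | nil => rfl
      | cons c r ih' =>
        rw [List.map_cons, List.cons_append, ← ih', Nat.add_comm]
        rfl
    · rfl

theorem mem_columnCodes {als : List (List ℕ)} {u c : ℕ} :
    c ∈ columnCodes als u ↔ ∃ s, List.Forall₂ (· ∈ ·) s als ∧ s.Nodup ∧
      (∀ v ∈ s, u.testBit v = false) ∧ c = code s := by
  induction als generalizing u c with
  | nil =>
    change c ∈ [0] ↔ _
    simp [code]
  | cons al als ih =>
    rw [columnCodes_cons]
    simp only [List.mem_flatMap, List.forall₂_cons_right_iff]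
    constructor
    · rintro ⟨v, hv, hc⟩
      split_ifs at hc with hu
      · simp at hc
      · obtain ⟨d, hd, rfl⟩ := List.mem_map.1 hc
        obtain ⟨s, hs, hnd, hus, rfl⟩ := ih.1 hd
        have hus' : ∀ x ∈ s, u.testBit x = false ∧ v ≠ x := fun x hx => by
          simpa [Nat.testBit_two_pow] using hus x hx
        refine ⟨v :: s, ⟨v, s, hv, hs, rfl⟩, List.nodup_cons.2 ⟨fun h => (hus' v h).2 rfl, hnd⟩,
          List.forall_mem_cons.2 ⟨by simpa using hu, fun x hx => (hus' x hx).1⟩, rfl⟩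
    · rintro ⟨_, ⟨v, s, hv, hs, rfl⟩, hnd, hus, rfl⟩
      rw [List.forall_mem_cons] at hus
      rw [List.nodup_cons] at hnd
      refine ⟨v, hv, ?_⟩
      rw [hus.1, if_neg Bool.false_ne_true]
      refine List.mem_map.2 ⟨code s, ih.2 ⟨s, hs, hnd.2, fun x hx => ?_, rfl⟩, rfl⟩
      have : v ≠ x := fun h => hnd.1 (h ▸ hx)
      simp [hus.2 x hx, this]

theorem nodup_columnCodes {als : List (List ℕ)} (h : ∀ al ∈ als, al.Nodup ∧ ∀ v ∈ al, v < 8)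
    (u : ℕ) : (columnCodes als u).Nodup := by
  induction als generalizing u with
  | nil => exact List.nodup_singleton 0
  | cons al als ih =>
    rw [List.forall_mem_cons] at h
    rw [columnCodes_cons, List.nodup_flatMap]
    refine ⟨fun v _ => ?_, ?_⟩
    · split_ifs
      · exact List.nodup_nil
      · exact (ih h.2 _).map fun a b hab => by simpa using hab
    · refine h.1.1.imp_of_mem fun {v w} hv hw hvw c hc hc' => hvw ?_
      have hv := two_pow_lt_two_pow_8 (h.1.2 v hv)
      have hw := two_pow_lt_two_pow_8 (h.1.2 w hw)
      simp only [List.mem_ite_nil_left, List.mem_map] at hc hc'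
      obtain ⟨-, d, -, rfl⟩ := hc
      obtain ⟨-, d', -, hd'⟩ := hc'
      exact Nat.pow_right_injective le_rfl (two_pow_8_mul_add_inj hw hv hd').2.symm

theorem code_lt {s : List ℕ} (hs : ∀ v ∈ s, v < 8) : code s < 2 ^ (8 * s.length) := by
  induction s with
  | nil => simp [code]
  | cons v s ih =>
    rw [List.forall_mem_cons] at hs
    have := ih hs.2
    have := two_pow_lt_two_pow_8 hs.1
    rw [List.length_cons, Nat.mul_succ, Nat.add_comm (8 * _), pow_add, code]
    nlinarith

theorem code_injective {s t : List ℕ} (hs : ∀ v ∈ s, v < 8) (ht : ∀ v ∈ t, v < 8)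
    (hlen : s.length = t.length) (h : code s = code t) : s = t := by
  induction s generalizing t with
  | nil => exact (List.length_eq_zero_iff.1 hlen.symm).symm
  | cons v s ih =>
    cases t with
    | nil => simp at hlen
    | cons w t =>
      rw [List.forall_mem_cons] at hs ht
      have hv := two_pow_lt_two_pow_8 hs.1
      have hw := two_pow_lt_two_pow_8 ht.1
      rw [code, code] at h
      obtain ⟨h2, h1⟩ := two_pow_8_mul_add_inj hv hw h
      rw [ih hs.2 ht.2 (by simpa using hlen) h2, Nat.pow_right_injective le_rfl h1]

theorem code_land_code_eq_zero {s t : List ℕ} (hs : ∀ v ∈ s, v < 8) (ht : ∀ v ∈ t, v < 8)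
    (hlen : s.length = t.length) : code s &&& code t = 0 ↔ List.Forall₂ (· ≠ ·) s t := by
  induction s generalizing t with
  | nil => simp [List.length_eq_zero_iff.1 hlen.symm, code]
  | cons v s ih =>
    cases t with
    | nil => simp at hlen
    | cons w t =>
      rw [List.forall_mem_cons] at hs ht
      rw [code, code, land_two_pow_mul_add (two_pow_lt_two_pow_8 hs.1) (two_pow_lt_two_pow_8 ht.1),
        List.forall₂_cons, ← ih hs.2 ht.2 (by simpa using hlen), Nat.add_eq_zero_iff, and_comm]
      refine and_congr ?_ (by simp)
      rw [Nat.and_two_pow, Nat.testBit_two_pow]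
      by_cases h : v = w <;> simp [h]

/-- The code of a column. -/
def columnCode (f : Fin 8 → Fin 8) : ℕ := code (List.ofFn fun i => (f i : ℕ))

theorem forall_mem_ofFn_lt (f : Fin 8 → Fin 8) : ∀ v ∈ List.ofFn fun i => (f i : ℕ), v < 8 := by
  intro v hv
  obtain ⟨i, rfl⟩ := List.mem_ofFn.1 hv
  exact (f i).2

theorem columnCode_lt (f : Fin 8 → Fin 8) : columnCode f < 2 ^ 64 := by
  have := code_lt (forall_mem_ofFn_lt f)
  rwa [List.length_ofFn] at this

theorem columnCode_injective : Function.Injective columnCode := fun f g h => by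
  have := code_injective (forall_mem_ofFn_lt f) (forall_mem_ofFn_lt g) (by simp) h
  funext i
  exact Fin.val_injective (congrFun (List.ofFn_injective this) i)

theorem columnCode_land_eq_zero {f g : Fin 8 → Fin 8} :
    columnCode f &&& columnCode g = 0 ↔ ∀ i, f i ≠ g i := by
  unfold columnCode
  rw [code_land_code_eq_zero (forall_mem_ofFn_lt f) (forall_mem_ofFn_lt g) (by simp),
    List.forall₂_iff_get]
  simp only [List.length_ofFn, true_and, List.get_eq_getElem, List.getElem_ofFn]
  constructor
  · intro h i hi
    exact h i i.2 i.2 (congrArg _ hi)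
  · intro h i hi _ hv
    exact h ⟨i, hi⟩ (Fin.val_injective hv)

theorem mem_columnCodes_iff {als : List (List ℕ)} (hlen : als.length = 8)
    (h : ∀ al ∈ als, ∀ v ∈ al, v < 8) {c : ℕ} :
    c ∈ columnCodes als 0 ↔ ∃ f : Fin 8 → Fin 8, Function.Injective f ∧
      (∀ i : Fin 8, (f i : ℕ) ∈ als.getD i []) ∧ c = columnCode f := by
  rw [mem_columnCodes]
  have hget : ∀ i : Fin 8, als.getD i [] = als[(i : ℕ)]'(by omega) := fun i => by
    rw [List.getD_eq_getElem]
  constructor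
  · rintro ⟨s, hs, hnd, -, rfl⟩
    have hsl : s.length = 8 := hs.length_eq.trans hlen
    rw [List.forall₂_iff_get] at hs
    have hmem : ∀ i : Fin 8, s[(i : ℕ)]'(by omega) ∈ als[(i : ℕ)]'(by omega) := fun i =>
      hs.2 i (by omega) (by omega)
    have hlt : ∀ i : Fin 8, s[(i : ℕ)]'(by omega) < 8 := fun i =>
      h _ (List.getElem_mem _) _ (hmem i)
    refine ⟨fun i => ⟨s[(i : ℕ)]'(by omega), hlt i⟩, fun i j hij => ?_, fun i => ?_, ?_⟩
    · exact Fin.val_injective ((hnd.getElem_inj_iff).1 (congrArg Fin.val hij))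
    · rw [hget]
      exact hmem i
    · unfold columnCode
      congr 1
      exact List.ext_getElem (hsl.trans List.length_ofFn.symm) fun i h₁ h₂ => by
        rw [List.getElem_ofFn]
  · rintro ⟨f, hf, hmem, rfl⟩
    refine ⟨_, ?_, List.nodup_ofFn.2 (Fin.val_injective.comp hf), fun v _ => Nat.zero_testBit v,
      rfl⟩
    rw [List.forall₂_iff_get]
    refine ⟨by simp [hlen], fun i h₁ h₂ => ?_⟩
    have hi : i < 8 := hlen ▸ h₂
    rw [List.get_eq_getElem, List.get_eq_getElem, List.getElem_ofFn]
    exact hget ⟨i, hi⟩ ▸ hmem ⟨i, hi⟩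

/-- The lists of pairwise disjoint codes, also disjoint from `U`, with one code from each list. -/
def tuples : List (List ℕ) → ℕ → List (List ℕ)
  | [], _ => [[]]
  | l :: ls, U => l.flatMap fun c =>
      if c &&& U = 0 then (tuples ls (U ||| c)).map (c :: ·) else []

theorem length_tuples (ls : List (List ℕ)) (U : ℕ) : (tuples ls U).length = choices ls U := by
  induction ls generalizing U with
  | nil => rfl
  | cons l ls ih =>
    rw [tuples, choices, List.length_flatMap]
    congr 2
    funext c
    split_ifs
    · rw [List.length_map, ih]
    · rfl

theorem nodup_tuples {ls : List (List ℕ)} (h : ∀ l ∈ ls, l.Nodup) (U : ℕ) :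
    (tuples ls U).Nodup := by
  induction ls generalizing U with
  | nil => exact List.nodup_singleton []
  | cons l ls ih =>
    rw [List.forall_mem_cons] at h
    rw [tuples, List.nodup_flatMap]
    refine ⟨fun c _ => ?_, h.1.imp fun {c d} hcd t ht ht' => hcd ?_⟩
    · split_ifs
      · exact (ih h.2 _).map (List.cons_injective)
      · exact List.nodup_nil
    · simp only [List.mem_ite_nil_right, List.mem_map] at ht ht'
      obtain ⟨-, t₁, -, rfl⟩ := ht
      obtain ⟨-, t₂, -, h₂⟩ := ht'
      exact (List.cons.inj h₂).1.symm

theorem mem_tuples {ls : List (List ℕ)} {U : ℕ} {t : List ℕ} :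
    t ∈ tuples ls U ↔ List.Forall₂ (· ∈ ·) t ls ∧ (∀ c ∈ t, c &&& U = 0) ∧
      t.Pairwise fun c d => c &&& d = 0 := by
  induction ls generalizing U t with
  | nil =>
    simp only [tuples, List.mem_singleton, List.forall₂_nil_right_iff]
    constructor
    · rintro rfl
      simp
    · exact fun h => h.1
  | cons l ls ih =>
    simp only [tuples, List.mem_flatMap, List.forall₂_cons_right_iff]
    constructor
    · rintro ⟨c, hc, ht⟩
      split_ifs at ht with hcU
      · obtain ⟨t, ht', rfl⟩ := List.mem_map.1 ht
        obtain ⟨h₁, h₂, h₃⟩ := ih.1 ht'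
        simp only [land_lor_eq_zero] at h₂
        exact ⟨⟨c, t, hc, h₁, rfl⟩, List.forall_mem_cons.2 ⟨hcU, fun d hd => (h₂ d hd).1⟩,
          List.pairwise_cons.2 ⟨fun d hd => (Nat.and_comm c d).trans (h₂ d hd).2, h₃⟩⟩
      · simp at ht
    · rintro ⟨⟨c, t, hc, h₁, rfl⟩, h₂, h₃⟩
      rw [List.forall_mem_cons] at h₂
      rw [List.pairwise_cons] at h₃
      refine ⟨c, hc, ?_⟩
      rw [if_pos h₂.1]
      exact List.mem_map.2 ⟨t, ih.2 ⟨h₁, fun d hd => land_lor_eq_zero.2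
        ⟨h₂.2 d hd, (Nat.and_comm d c).trans (h₃.1 d hd)⟩, h₃.2⟩, rfl⟩

/-- The possible sets of symbols of the columns 1, 6, 7, 3 in row 3, as bit sets, with the numbers
of completions. -/
def classTable : List (ℕ × ℕ) :=
  [(15, 15954), (23, 11932), (27, 28773), (29, 27531), (30, 19355), (39, 48511), (43, 98968),
   (45, 87424), (46, 70233), (51, 77789), (53, 68666), (54, 63838), (57, 122528), (58, 103271),
   (60, 134074), (71, 61621), (75, 107955), (77, 111435), (78, 86467), (83, 94624), (85, 97175),
   (86, 76667), (89, 139662), (90, 96160), (92, 147690), (99, 440103), (101, 351748),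
   (102, 326254), (105, 643009), (106, 430362), (108, 585884), (113, 518807), (114, 471517),
   (116, 574090), (120, 735111)]

theorem classCheck_15 : classCheck 15 15954 = true := by decide +kernel

theorem classCheck_23 : classCheck 23 11932 = true := by decide +kernel

theorem classCheck_27 : classCheck 27 28773 = true := by decide +kernel

theorem classCheck_29 : classCheck 29 27531 = true := by decide +kernel

theorem classCheck_30 : classCheck 30 19355 = true := by decide +kernel

theorem classCheck_39 : classCheck 39 48511 = true := by decide +kernel

theorem classCheck_43 : classCheck 43 98968 = true := by decide +kernel

theorem classCheck_45 : classCheck 45 87424 = true := by decide +kernel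

theorem classCheck_46 : classCheck 46 70233 = true := by decide +kernel

theorem classCheck_51 : classCheck 51 77789 = true := by decide +kernel

theorem classCheck_53 : classCheck 53 68666 = true := by decide +kernel

theorem classCheck_54 : classCheck 54 63838 = true := by decide +kernel

theorem classCheck_57 : classCheck 57 122528 = true := by decide +kernel

theorem classCheck_58 : classCheck 58 103271 = true := by decide +kernel

theorem classCheck_60 : classCheck 60 134074 = true := by decide +kernel

theorem classCheck_71 : classCheck 71 61621 = true := by decide +kernel

theorem classCheck_75 : classCheck 75 107955 = true := by decide +kernel

theorem classCheck_77 : classCheck 77 111435 = true := by decide +kernel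

theorem classCheck_78 : classCheck 78 86467 = true := by decide +kernel

theorem classCheck_83 : classCheck 83 94624 = true := by decide +kernel

theorem classCheck_85 : classCheck 85 97175 = true := by decide +kernel

theorem classCheck_86 : classCheck 86 76667 = true := by decide +kernel

theorem classCheck_89 : classCheck 89 139662 = true := by decide +kernel

theorem classCheck_90 : classCheck 90 96160 = true := by decide +kernel

theorem classCheck_92 : classCheck 92 147690 = true := by decide +kernel

theorem classCheck_99 : classCheck 99 440103 = true := by decide +kernel

theorem classCheck_101 : classCheck 101 351748 = true := by decide +kernel

theorem classCheck_102 : classCheck 102 326254 = true := by decide +kernel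

theorem classCheck_105 : classCheck 105 643009 = true := by decide +kernel

theorem classCheck_106 : classCheck 106 430362 = true := by decide +kernel

theorem classCheck_108 : classCheck 108 585884 = true := by decide +kernel

theorem classCheck_113 : classCheck 113 518807 = true := by decide +kernel

theorem classCheck_114 : classCheck 114 471517 = true := by decide +kernel

theorem classCheck_116 : classCheck 116 574090 = true := by decide +kernel

theorem classCheck_120 : classCheck 120 735111 = true := by decide +kernel

theorem classCheck_of_mem : ∀ p ∈ classTable, classCheck p.1 p.2 = true := by
  simp only [classTable, List.forall_mem_cons]
  exact ⟨classCheck_15, classCheck_23, classCheck_27, classCheck_29, classCheck_30, classCheck_39,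
    classCheck_43, classCheck_45, classCheck_46, classCheck_51, classCheck_53, classCheck_54,
    classCheck_57, classCheck_58, classCheck_60, classCheck_71, classCheck_75, classCheck_77,
    classCheck_78, classCheck_83, classCheck_85, classCheck_86, classCheck_89, classCheck_90,
    classCheck_92, classCheck_99, classCheck_101, classCheck_102, classCheck_105, classCheck_106,
    classCheck_108, classCheck_113, classCheck_114, classCheck_116, classCheck_120, nofun⟩

/-- The columns other than column 5, in the order in which they are filled. -/
def columnOrder : Fin 7 → Fin 8 := ![1, 6, 7, 3, 4, 0, 2]

/-- The position of a column in `columnOrder`, counted from 1; column 5 has position 0. -/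
def columnPosition : Fin 8 → Fin 8 := ![6, 1, 7, 4, 5, 0, 2, 3]

/-- Seven columns of a Latin square. -/
def IsRectangle (g : Fin 7 → Fin 8 → Fin 8) : Prop :=
  (∀ k, Function.Injective (g k)) ∧ ∀ k k', k ≠ k' → ∀ i, g k i ≠ g k' i

/-- The rectangles that obey the clues and have the symbols in `m` in row 3 of the first four
columns. -/
def classRectangles (m : ℕ) : Set (Fin 7 → Fin 8 → Fin 8) :=
  {g | IsRectangle g ∧ ∀ (k : Fin 7) (i : Fin 8), (g k i : ℕ) ∈ (allowed m k).getD i []}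

theorem restrict_sublist (m : ℕ) (al : List ℕ) : (restrict m al).Sublist al := by
  induction al with
  | nil => exact List.Sublist.slnil
  | cons w al ih =>
    change (Bool.rec (restrict m al) (w :: restrict m al)
      (Nat.beq 1 (Nat.mod (Nat.shiftRight m w) 2)) : List ℕ).Sublist _
    cases Nat.beq 1 (Nat.mod (Nat.shiftRight m w) 2)
    exacts [ih.cons _, ih.cons_cons _]

theorem length_allowed (m : ℕ) (k : Fin 7) : (allowed m k).length = 8 := by
  fin_cases k <;> rfl

theorem nodup_and_lt_of_sublist {al bl : List ℕ} (h : al.Sublist bl)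
    (hbl : bl.Nodup ∧ ∀ v ∈ bl, v < 8) : al.Nodup ∧ ∀ v ∈ al, v < 8 :=
  ⟨hbl.1.sublist h, fun v hv => hbl.2 v (h.subset hv)⟩

theorem nodup_and_lt_of_mem_allowed (m : ℕ) (k : Fin 7) :
    ∀ al ∈ allowed m k, al.Nodup ∧ ∀ v ∈ al, v < 8 := by
  have h := fun m => nodup_and_lt_of_sublist (restrict_sublist m [0, 1, 2, 3, 4, 5, 6]) (by decide)
  fin_cases k <;>
  · iterate 8 refine List.forall_mem_cons.2 ⟨by first | exact h _ | decide, ?_⟩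
    exact List.forall_mem_nil _

theorem nodup_codes (m : ℕ) (k : Fin 7) : (codes m k).Nodup :=
  nodup_columnCodes (nodup_and_lt_of_mem_allowed m k) 0

theorem mem_codes {m : ℕ} {k : Fin 7} {c : ℕ} :
    c ∈ codes m k ↔ ∃ f : Fin 8 → Fin 8, Function.Injective f ∧
      (∀ i : Fin 8, (f i : ℕ) ∈ (allowed m k).getD i []) ∧ c = columnCode f :=
  mem_columnCodes_iff (length_allowed m k) fun al h => (nodup_and_lt_of_mem_allowed m k al h).2

theorem ncard_classRectangles (m : ℕ) :
    (classRectangles m).ncard = choices (List.ofFn (codes m)) 0 := by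
  have hinj : Function.Injective fun g : Fin 7 → Fin 8 → Fin 8 =>
      List.ofFn fun k => columnCode (g k) := fun g g' h => by
    funext k
    exact columnCode_injective (congrFun (List.ofFn_injective h) k)
  rw [← Set.ncard_image_of_injective _ hinj, ← length_tuples, ← List.toFinset_card_of_nodup
    (nodup_tuples (fun l hl => by
      obtain ⟨k, rfl⟩ := List.mem_ofFn.1 hl
      exact nodup_codes m k) 0), ← Set.ncard_coe_finset]
  congr 1
  ext t
  rw [List.coe_toFinset, Set.mem_ofPred_eq, mem_tuples, List.forall₂_iff_get]
  constructor
  · rintro ⟨g, ⟨hg, hal⟩, rfl⟩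
    refine ⟨⟨by simp only [List.length_ofFn], fun k h₁ h₂ => ?_⟩, fun c _ => Nat.and_zero c, ?_⟩
    · simp only [List.get_eq_getElem, List.getElem_ofFn]
      exact mem_codes.2 ⟨_, hg.1 _, hal _, rfl⟩
    · rw [List.pairwise_ofFn]
      exact fun k k' hk => columnCode_land_eq_zero.2 (hg.2 k k' hk.ne)
  · rintro ⟨⟨hlen, hmem⟩, -, hpw⟩
    rw [List.length_ofFn] at hlen
    have hmem' : ∀ k : Fin 7, t[(k : ℕ)]'(by omega) ∈ codes m k := fun k => by
      have := hmem k (by omega) (by rw [List.length_ofFn]; omega)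
      rwa [List.get_eq_getElem, List.get_eq_getElem, List.getElem_ofFn] at this
    choose g hg hal hc using fun k => mem_codes.1 (hmem' k)
    have ht : (List.ofFn fun k => columnCode (g k)) = t :=
      List.ext_getElem (List.length_ofFn.trans hlen.symm) fun k h₁ h₂ => by
        rw [List.getElem_ofFn]
        exact (hc _).symm
    refine ⟨g, ⟨⟨hg, fun k k' hk => ?_⟩, hal⟩, ht⟩
    rw [← ht, List.pairwise_ofFn] at hpw
    rcases lt_or_gt_of_ne hk with h | h
    · exact columnCode_land_eq_zero.1 (hpw h)
    · exact fun i => (columnCode_land_eq_zero.1 (hpw h) i).symm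

theorem classCount_eq {m v : ℕ} (h : classCheck m v = true) : (classRectangles m).ncard = v := by
  rw [ncard_classRectangles]
  have h' : shortClass m = true ∧ Nat.beq (classCount m) v = true := (Bool.and_eq_true _ _).mp h
  rw [← Nat.eq_of_beq_eq_true h'.2]
  have hshort : ∀ l, short l = true → l.length ≤ 148 := fun l hl =>
    len_eq l ▸ Nat.le_of_ble_eq_true hl
  have hs := h'.1
  simp only [shortClass, Bool.and_eq_true] at hs
  refine (count_eq_choices ?_ ?_).symm
  · simp only [List.forall_mem_cons]
    exact ⟨hshort _ hs.1, hshort _ hs.2.1, hshort _ hs.2.2.1, hshort _ hs.2.2.2.1,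
      hshort _ hs.2.2.2.2.1, hshort _ hs.2.2.2.2.2.1, hshort _ hs.2.2.2.2.2.2, nofun⟩
  · have hlt : ∀ k, ∀ c ∈ codes m k, c < 2 ^ 64 := fun k c hc => by
      obtain ⟨f, -, -, rfl⟩ := mem_codes.1 hc
      exact columnCode_lt f
    simp only [List.forall_mem_cons]
    exact ⟨hlt 0, hlt 1, hlt 2, hlt 3, hlt 4, hlt 5, hlt 6, nofun⟩

theorem eq_five_or_exists_columnOrder (j : Fin 8) : j = 5 ∨ ∃ k, columnOrder k = j := by
  revert j; decide

theorem columnOrder_ne_five (k : Fin 7) : columnOrder k ≠ 5 := by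
  revert k; decide

theorem columnOrder_injective : Function.Injective columnOrder := by
  decide

theorem columnPosition_injective : Function.Injective columnPosition := by
  decide

theorem columnPosition_columnOrder (k : Fin 7) : columnPosition (columnOrder k) = k.succ := by
  revert k; decide

theorem IsRectangle.exists_isLatinSquare {g : Fin 7 → Fin 8 → Fin 8} (hg : IsRectangle g) :
    ∃ L, IsLatinSquare L ∧ ∀ i k, L i (columnOrder k) = g k i := by
  have hrow : ∀ i, Function.Injective fun k => g k i := fun i k k' h => by
    by_contra hk
    exact hg.2 k k' hk i h
  have hx : ∀ i, ∃ x, x ∉ Set.range fun k => g k i := fun i => by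
    by_contra! h
    have := Fintype.card_le_of_surjective _ h
    simp at this
  choose x hx using hx
  have hxinj : Function.Injective x := fun i i' hii' => by
    by_contra hne
    choose r hr using fun k => (Finite.injective_iff_surjective.1 (hg.1 k)) (x i)
    have hrinj : Function.Injective r := fun k k' h => by
      by_contra hk
      exact hg.2 k k' hk (r k) ((hr k).trans (h ▸ (hr k').symm))
    have hsub : Finset.univ.image r ⊆ (Finset.univ.erase i).erase i' := fun y hy => by
      obtain ⟨k, -, rfl⟩ := Finset.mem_image.1 hy
      refine Finset.mem_erase.2 ⟨fun h => ?_, Finset.mem_erase.2 ⟨fun h => ?_, Finset.mem_univ _⟩⟩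
      · exact hx i' ⟨k, hii' ▸ h ▸ hr k⟩
      · exact hx i ⟨k, h ▸ hr k⟩
    have := Finset.card_le_card hsub
    rw [Finset.card_image_of_injective _ hrinj, Finset.card_erase_of_mem (Finset.mem_erase.2
      ⟨fun h => hne h.symm, Finset.mem_univ _⟩),
      Finset.card_erase_of_mem (Finset.mem_univ _)] at this
    simp at this
  refine ⟨fun i j => (Fin.cons (x i) (fun k => g k i) : Fin 8 → Fin 8) (columnPosition j),
    ⟨fun i => ?_, fun j => ?_⟩, fun i k => ?_⟩
  · exact (Fin.cons_injective_iff.2 ⟨hx i, hrow i⟩).comp columnPosition_injective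
  · rcases Fin.eq_zero_or_eq_succ (columnPosition j) with h | ⟨k, h⟩
    · simpa only [h, Fin.cons_zero] using hxinj
    · simpa only [h, Fin.cons_succ] using hg.1 k
  · simp only [columnPosition_columnOrder, Fin.cons_succ]

theorem subset_entries_iff {n : ℕ} {L : Fin n → Fin n → Fin n}
    {U : Finset (Fin n × Fin n × Fin n)} :
    U ⊆ entries L ↔ ∀ t ∈ U, L t.1 t.2.1 = t.2.2 := by
  refine forall₂_congr fun t _ => ?_
  simp only [entries, Finset.mem_image, Finset.mem_univ, true_and]
  constructor
  · rintro ⟨p, rfl⟩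
    rfl
  · intro h
    exact ⟨(t.1, t.2.1), by rw [h]⟩

/-- The set of symbols in row 3 of the first four columns in `columnOrder`. -/
def rowMask (L : Fin 8 → Fin 8 → Fin 8) : ℕ :=
  2 ^ (L 3 (columnOrder 0) : ℕ) ||| 2 ^ (L 3 (columnOrder 1) : ℕ) |||
    2 ^ (L 3 (columnOrder 2) : ℕ) ||| 2 ^ (L 3 (columnOrder 3) : ℕ)

theorem testBit_rowMask {L : Fin 8 → Fin 8 → Fin 8} (hL : IsLatinSquare L) (k : Fin 7) :
    (rowMask L).testBit (L 3 (columnOrder k)) = true ↔ k < 4 := by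
  simp only [rowMask, Nat.testBit_or, Nat.testBit_two_pow, Bool.or_eq_true, decide_eq_true_eq,
    Fin.val_inj, (hL.1 3).eq_iff, columnOrder_injective.eq_iff]
  revert k
  decide

theorem mem_classTable_of_ne : ∀ a b c d : Fin 8, a ≠ 7 → b ≠ 7 → c ≠ 7 → d ≠ 7 → a ≠ b → a ≠ c →
    a ≠ d → b ≠ c → b ≠ d → c ≠ d →
    2 ^ (a : ℕ) ||| 2 ^ (b : ℕ) ||| 2 ^ (c : ℕ) ||| 2 ^ (d : ℕ) ∈ classTable.map Prod.fst := by
  decide +kernel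

set_option synthInstance.maxSize 1000 in
set_option synthInstance.maxHeartbeats 200000 in
theorem eq_of_mem_classTable : ∀ m ∈ classTable.map Prod.fst,
    ∀ a : Fin 8, m.testBit a = true → ∀ b : Fin 8, m.testBit b = true → a ≠ b →
    ∀ c : Fin 8, m.testBit c = true → a ≠ c → b ≠ c →
    ∀ d : Fin 8, m.testBit d = true → a ≠ d → b ≠ d → c ≠ d →
    2 ^ (a : ℕ) ||| 2 ^ (b : ℕ) ||| 2 ^ (c : ℕ) ||| 2 ^ (d : ℕ) = m := by
  decide +kernel

theorem allowed_getD_of_ne (m : ℕ) (k : Fin 7) (i : Fin 8) (hi : i ≠ 3) :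
    (allowed m k).getD i [] = (allowed 0 k).getD i [] := by
  fin_cases k <;> fin_cases i <;> first | rfl | exact absurd rfl hi

set_option maxRecDepth 10000 in
theorem mem_allowed_zero_iff : ∀ (k : Fin 7) (i : Fin 8), i ≠ 3 → ∀ v : Fin 8,
    (v : ℕ) ∈ (allowed 0 k).getD i [] ↔
      ∀ t ∈ W1, t.1 = i → (t.2.1 = columnOrder k ↔ t.2.2 = v) := by
  decide +kernel

set_option maxRecDepth 10000 in
theorem mem_allowed_three_iff : ∀ m ∈ classTable.map Prod.fst, ∀ (k : Fin 7) (v : Fin 8),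
    (v : ℕ) ∈ (allowed m k).getD 3 [] ↔
      (columnOrder k = 4 ↔ v = 7) ∧ (m.testBit v = true ↔ k < 4) := by
  decide +kernel

set_option maxRecDepth 10000 in
theorem mem_W1_three : ∀ t ∈ W1, t.1 = 3 ↔ t = (3, 4, 7) := by
  decide

theorem mem_allowed_iff {m : ℕ} (hm : m ∈ classTable.map Prod.fst) (k : Fin 7) (i v : Fin 8) :
    (v : ℕ) ∈ (allowed m k).getD i [] ↔
      (∀ t ∈ W1, t.1 = i → (t.2.1 = columnOrder k ↔ t.2.2 = v)) ∧
        (i = 3 → (m.testBit v = true ↔ k < 4)) := by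
  by_cases hi : i = 3
  · subst hi
    refine (mem_allowed_three_iff m hm k v).trans (and_congr ?_ (by simp))
    constructor
    · intro h t ht h3
      rw [(mem_W1_three t ht).1 h3]
      simpa [eq_comm] using h
    · intro h
      simpa [eq_comm] using h (3, 4, 7) (by decide) rfl
  · rw [allowed_getD_of_ne m k i hi, mem_allowed_zero_iff k i hi]
    simp [hi]

/-- The completions of `W1` whose row mask is `m`. -/
def classCompletions (m : ℕ) : Set (Fin 8 → Fin 8 → Fin 8) :=
  {L | (IsLatinSquare L ∧ W1 ⊆ entries L) ∧ rowMask L = m}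

theorem IsLatinSquare.eq_of_columnOrder {L L' : Fin 8 → Fin 8 → Fin 8} (hL : IsLatinSquare L)
    (hL' : IsLatinSquare L') (h : ∀ i k, L i (columnOrder k) = L' i (columnOrder k)) : L = L' := by
  funext i j
  rcases eq_five_or_exists_columnOrder j with rfl | ⟨k, rfl⟩
  · obtain ⟨j, hj⟩ := (Finite.injective_iff_surjective.1 (hL.1 i)) (L' i 5)
    rcases eq_five_or_exists_columnOrder j with rfl | ⟨k, rfl⟩
    · exact hj
    · exact absurd (hL'.1 i ((h i k).symm.trans hj)) (columnOrder_ne_five k)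
  · exact h i k

theorem ncard_classCompletions {m : ℕ} (hm : m ∈ classTable.map Prod.fst) :
    (classCompletions m).ncard = (classRectangles m).ncard := by
  have hinj : Set.InjOn (fun (L : Fin 8 → Fin 8 → Fin 8) k i => L i (columnOrder k))
      (classCompletions m) := fun L hL L' hL' h =>
    hL.1.1.eq_of_columnOrder hL'.1.1 fun i k => congrFun (congrFun h k) i
  rw [← hinj.ncard_image]
  congr 1
  ext g
  constructor
  · rintro ⟨L, ⟨⟨hL, hW⟩, rfl⟩, rfl⟩
    rw [subset_entries_iff] at hW
    refine ⟨⟨fun k => hL.2 _, fun k k' hk i h => hk (columnOrder_injective (hL.1 i h))⟩,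
      fun k i => (mem_allowed_iff hm k i _).2 ⟨fun t ht hi => ?_, ?_⟩⟩
    · rw [← hW t ht, ← hi, (hL.1 _).eq_iff]
    · rintro rfl
      exact testBit_rowMask hL k
  · rintro ⟨hg, hal⟩
    obtain ⟨L, hL, hLg⟩ := hg.exists_isLatinSquare
    simp only [← hLg, mem_allowed_iff hm] at hal
    have hmask : ∀ k < 4, m.testBit (L 3 (columnOrder k)) = true := fun k hk =>
      ((hal k 3).2 rfl).2 hk
    have hne : ∀ k k', k ≠ k' → L 3 (columnOrder k) ≠ L 3 (columnOrder k') := fun k k' hk h =>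
      hk (columnOrder_injective (hL.1 3 h))
    refine ⟨L, ⟨⟨hL, subset_entries_iff.2 fun t ht => ?_⟩, ?_⟩, ?_⟩
    · rcases eq_five_or_exists_columnOrder t.2.1 with h5 | ⟨k, hk⟩
      · obtain ⟨j, hj⟩ := (Finite.injective_iff_surjective.1 (hL.1 t.1)) t.2.2
        rcases eq_five_or_exists_columnOrder j with rfl | ⟨k, rfl⟩
        · rw [h5, hj]
        · rw [((hal k t.1).1 t ht rfl).2 hj.symm, hj]
      · rw [← hk]
        exact (((hal k t.1).1 t ht rfl).1 hk.symm).symm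
    · exact eq_of_mem_classTable m hm _ (hmask 0 (by decide)) _ (hmask 1 (by decide))
        (hne 0 1 (by decide)) _ (hmask 2 (by decide)) (hne 0 2 (by decide)) (hne 1 2 (by decide)) _
        (hmask 3 (by decide)) (hne 0 3 (by decide)) (hne 1 3 (by decide)) (hne 2 3 (by decide))
    · funext k i
      exact hLg i k

theorem rowMask_mem {L : Fin 8 → Fin 8 → Fin 8} (hL : IsLatinSquare L) (hW : W1 ⊆ entries L) :
    rowMask L ∈ classTable.map Prod.fst := by
  have h34 : L 3 4 = 7 := subset_entries_iff.1 hW (3, 4, 7) (by decide)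
  have h7 : ∀ k, k ≠ 4 → L 3 (columnOrder k) ≠ 7 := fun k hk h =>
    hk (columnOrder_injective (hL.1 3 (h.trans h34.symm)))
  have hne : ∀ k k', k ≠ k' → L 3 (columnOrder k) ≠ L 3 (columnOrder k') := fun k k' hk h =>
    hk (columnOrder_injective (hL.1 3 h))
  exact mem_classTable_of_ne _ _ _ _ (h7 0 (by decide)) (h7 1 (by decide)) (h7 2 (by decide))
    (h7 3 (by decide)) (hne 0 1 (by decide)) (hne 0 2 (by decide)) (hne 0 3 (by decide))
    (hne 1 2 (by decide)) (hne 1 3 (by decide)) (hne 2 3 (by decide))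

theorem nodup_classTable : (classTable.map Prod.fst).Nodup := by
  decide

theorem sum_classTable : (classTable.map Prod.snd).sum = 7075188 := by
  decide

theorem ncard_eq_sum_ncard_fibers {α β : Type*} [Finite α] {s : Set α} {f : α → β} {l : List β}
    (hl : l.Nodup) (h : ∀ x ∈ s, f x ∈ l) :
    s.ncard = (l.map fun b => {x | x ∈ s ∧ f x = b}.ncard).sum := by
  classical
  rw [Set.ncard_eq_toFinset_card s, Finset.card_eq_sum_card_fiberwise (f := f) (t := l.toFinset)
    fun x hx => by simpa using h x (by simpa using hx), List.sum_toFinset _ hl]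
  refine congrArg List.sum (List.map_congr_left fun b _ => ?_)
  rw [← Set.ncard_coe_finset]
  refine congrArg Set.ncard (Set.ext fun x => ?_)
  simp

theorem card_completions :
    Nat.card {L : Fin 8 → Fin 8 → Fin 8 // IsLatinSquare L ∧ W1 ⊆ entries L} = 7075188 := by
  refine (ncard_eq_sum_ncard_fibers (s := {L | IsLatinSquare L ∧ W1 ⊆ entries L}) (f := rowMask)
    nodup_classTable fun L hL => rowMask_mem hL.1 hL.2).trans ?_
  rw [List.map_map]
  refine (congrArg List.sum (List.map_congr_left fun p hp => ?_)).trans sum_classTable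
  rw [← classCount_eq (classCheck_of_mem p hp), ← ncard_classCompletions (List.mem_map_of_mem hp)]
  rfl

end

/-- `W₁` has exactly 7,075,188 completions to Latin squares of order 8; in
particular it is not a uniquely completable set for any Latin square of order 8. -/
theorem W1_completions :
    Nat.card {L : Fin 8 → Fin 8 → Fin 8 // IsLatinSquare L ∧ W1 ⊆ entries L} = 7075188 ∧
    ∀ L : Fin 8 → Fin 8 → Fin 8, IsLatinSquare L → ¬ IsUC L W1 := by
  refine ⟨card_completions, fun L _ hUC => ?_⟩
  have : Subsingleton {L : Fin 8 → Fin 8 → Fin 8 // IsLatinSquare L ∧ W1 ⊆ entries L} :=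
    ⟨fun M N => Subtype.ext ((hUC.2 M M.2.1 M.2.2).trans (hUC.2 N N.2.1 N.2.2).symm)⟩
  have := Finite.card_le_one_iff_subsingleton.2 this
  rw [card_completions] at this
  omega
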